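/- arXiv:2102.09290 — 4 statements merged into one kernel-verified Lean document; each statement's English description precedes it below -/
import Mathlib

section
/- Let ω > 0, a > 0, t̄ ∈ ℝ, Δ = π/(2ω), z2 ∈ ℝ and z4 > 0. Let x: (−∞, t̄] → ℝ⁴ be the solution of the robot dynamics with constant input u = (ω, −a) and terminal condition x(t̄) = (1, z2, π/2, z4), and let x′: (−∞, t̄] → ℝ⁴ be the solution with constant input u = (−ω, −a) and terminal condition x′(t̄) = (1, z2′, −π/2, z4), where z2′ = z2 − 2·∫₀^Δ (z4 + a·s)·cos(ω·s) ds. Then x(t̄ − Δ) = x′(t̄ − Δ); i.e., the backward extremal curve ending tangentially on the wall with orientation π/2 and the backward extremal curve ending tangentially with orientation −π/2 (with the same terminal speed) intersect at backward time Δ = π/(2ω). -/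
open Set

/-- The robot vector field f(x,u) = (x₄ cos x₃, x₄ sin x₃, u₁, u₂) on ℝ⁴ = ℝ×ℝ×ℝ×ℝ. -/
noncomputable def robotF (x : ℝ × ℝ × ℝ × ℝ) (u : ℝ × ℝ) : ℝ × ℝ × ℝ × ℝ :=
  (x.2.2.2 * Real.cos x.2.2.1, x.2.2.2 * Real.sin x.2.2.1, u.1, u.2)

/-- A scalar function whose derivative at `T - r`, for `0 ≤ r ≤ s`, is the continuous function `g r`
satisfies the fundamental theorem of calculus in backward time. -/
theorem eq_sub_integral_of_hasDerivAt_backward {f g : ℝ → ℝ} {T s : ℝ} (hs : 0 ≤ s)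
    (hg : Continuous g) (hf : ∀ r ∈ Icc 0 s, HasDerivAt f (g r) (T - r)) :
    f (T - s) = f T - ∫ r in (0 : ℝ)..s, g r := by
  have key := intervalIntegral.integral_eq_sub_of_hasDerivAt (a := 0) (b := s)
    (f := fun r => -f (T - r)) (f' := g)
    (fun r hr => by
      rw [uIcc_of_le hs] at hr
      simpa only [neg_neg] using ((hf r hr).comp_const_sub T r).fun_neg)
    (hg.intervalIntegrable _ _)
  simp only [sub_zero] at key
  linarith

/-- The robot trajectory with constant input `u`, integrated backwards from `x T = p`. -/
theorem robot_backward_trajectory {x : ℝ → ℝ × ℝ × ℝ × ℝ} {T u₁ u₂ p₁ p₂ p₃ p₄ s : ℝ}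
    (hx : ∀ t ≤ T, HasDerivAt x (robotF (x t) (u₁, u₂)) t)
    (hxT : x T = (p₁, p₂, p₃, p₄)) (hs : 0 ≤ s) :
    x (T - s) =
      (p₁ - ∫ r in (0 : ℝ)..s, (p₄ - u₂ * r) * Real.cos (p₃ - u₁ * r),
        p₂ - ∫ r in (0 : ℝ)..s, (p₄ - u₂ * r) * Real.sin (p₃ - u₁ * r),
        p₃ - u₁ * s, p₄ - u₂ * s) := by
  have hd (r : ℝ) (hr : 0 ≤ r) := hx (T - r) (sub_le_self T hr)
  have h₃ (r : ℝ) (hr : 0 ≤ r) : (x (T - r)).2.2.1 = p₃ - u₁ * r := by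
    have := eq_sub_integral_of_hasDerivAt_backward (f := fun t => (x t).2.2.1) (g := fun _ => u₁)
      hr continuous_const (fun q hq => (hd q hq.1).snd.snd.fst)
    simpa [hxT, mul_comm] using this
  have h₄ (r : ℝ) (hr : 0 ≤ r) : (x (T - r)).2.2.2 = p₄ - u₂ * r := by
    have := eq_sub_integral_of_hasDerivAt_backward (f := fun t => (x t).2.2.2) (g := fun _ => u₂)
      hr continuous_const (fun q hq => (hd q hq.1).snd.snd.snd)
    simpa [hxT, mul_comm] using this
  have h₁ := eq_sub_integral_of_hasDerivAt_backward (f := fun t => (x t).1) (T := T)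
    (g := fun r => (p₄ - u₂ * r) * Real.cos (p₃ - u₁ * r)) hs (by fun_prop) (fun q hq => by
      rw [← h₃ q hq.1, ← h₄ q hq.1]
      exact (hd q hq.1).fst)
  have h₂ := eq_sub_integral_of_hasDerivAt_backward (f := fun t => (x t).2.1) (T := T)
    (g := fun r => (p₄ - u₂ * r) * Real.sin (p₃ - u₁ * r)) hs (by fun_prop) (fun q hq => by
      rw [← h₃ q hq.1, ← h₄ q hq.1]
      exact (hd q hq.1).snd.fst)
  simp only [hxT] at h₁ h₂
  exact Prod.ext h₁ (Prod.ext h₂ (Prod.ext (h₃ s hs) (h₄ s hs)))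

/-- The backward extremal curve with constant input (ω, −a) ending tangentially on the
wall x₁ = 1 with orientation π/2 and terminal speed z₄, and the backward extremal curve
with constant input (−ω, −a) ending tangentially with orientation −π/2 and the same
terminal speed (with suitably shifted x₂-terminal value), intersect at backward time
Δ = π/(2ω): x(t̄ − Δ) = x'(t̄ − Δ). -/
theorem barrier_curves_intersect_at_stopping_point (ω a tbar z2 z4 : ℝ)
    (hω : 0 < ω) (ha : 0 < a) (hz4 : 0 < z4)
    (Δ : ℝ) (hΔ : Δ = Real.pi / (2 * ω))
    (z2' : ℝ) (hz2' : z2' = z2 - 2 * ∫ s in (0 : ℝ)..Δ, (z4 + a * s) * Real.cos (ω * s))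
    (x x' : ℝ → ℝ × ℝ × ℝ × ℝ)
    (hx : ∀ t ≤ tbar, HasDerivAt x (robotF (x t) (ω, -a)) t)
    (hxT : x tbar = (1, z2, Real.pi / 2, z4))
    (hx' : ∀ t ≤ tbar, HasDerivAt x' (robotF (x' t) (-ω, -a)) t)
    (hx'T : x' tbar = (1, z2', -(Real.pi / 2), z4)) :
    x (tbar - Δ) = x' (tbar - Δ) := by
  have hΔ₀ : 0 ≤ Δ := by rw [hΔ]; positivity
  have hωΔ : ω * Δ = Real.pi / 2 := by rw [hΔ]; field_simp
  have hcos (r : ℝ) : Real.cos (-(Real.pi / 2) - -ω * r) = Real.cos (Real.pi / 2 - ω * r) := by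
    rw [← Real.cos_neg]; ring_nf
  have hsin (r : ℝ) : Real.sin (-(Real.pi / 2) - -ω * r) = -Real.cos (ω * r) := by
    rw [← Real.sin_pi_div_two_sub, ← Real.sin_neg]; ring_nf
  rw [robot_backward_trajectory hx hxT hΔ₀, robot_backward_trajectory hx' hx'T hΔ₀, hz2']
  simp only [hcos, hsin, Real.sin_pi_div_two_sub, mul_neg, intervalIntegral.integral_neg]
  simp only [neg_mul, sub_neg_eq_add, hωΔ, Prod.mk.injEq, true_and, and_true]
  constructor <;> ring
end

section
/- Let ŭ1 < 0 < ū1, ŭ2 < 0, t̄ ∈ ℝ, t̂ = t̄ − π/(ū1 − ŭ1), z2 ∈ ℝ, z4 > 0. Let x: [t̂, t̄] → ℝ⁴ be the solution of the robot dynamics with constant input u = (ū1, ŭ2) and terminal condition x(t̄) = (1, z2, π/2, z4). Then for every t ∈ (t̂, t̄): x3(t) ∈ (−π/2, π/2), x4(t) > 0, and x1(t) < 1; in particular the backward extremal curve that reaches the wall x1 = 1 tangentially at time t̄ lies strictly in the interior of the feasible set {x1 < 1} for all t ∈ [t̂, t̄). -/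
open Set

/-- A function with constant derivative `c` on `[a, b]` is affine there with slope `c`. -/
theorem eq_add_mul_sub_of_hasDerivAt_const {f : ℝ → ℝ} {a b c : ℝ}
    (hf : ∀ t ∈ Icc a b, HasDerivAt f c t) {t : ℝ} (ht : t ∈ Icc a b) :
    f t = f b + c * (t - b) := by
  have hg : ∀ s ∈ Icc a b, HasDerivAt (fun s => f s - c * s) 0 s := fun s hs => by
    have h := (hf s hs).fun_sub ((hasDerivAt_id' s).const_mul c)
    rwa [mul_one, sub_self] at h
  have key := constant_of_has_deriv_right_zero
    (fun s hs => (hg s hs).continuousAt.continuousWithinAt)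
    (fun s hs => (hg s (Ico_subset_Icc_self hs)).hasDerivWithinAt)
  have h₁ := key t ht
  have h₂ := key b (right_mem_Icc.2 (ht.1.trans ht.2))
  linarith

/-- The backward extremal (barrier) curve with constant input (ū₁, ŭ₂) that reaches the
wall x₁ = 1 tangentially at time t̄ with terminal state (1, z₂, π/2, z₄), z₄ > 0,
satisfies on the open interval (t̂, t̄), t̂ = t̄ − π/(ū₁ − ŭ₁): x₃(t) ∈ (−π/2, π/2),
x₄(t) > 0 and x₁(t) < 1; in particular x₁(t) < 1 for all t ∈ [t̂, t̄). -/
theorem barrier_curve_strictly_feasible (u1lo u1hi u2lo : ℝ)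
    (h1lo : u1lo < 0) (h1hi : 0 < u1hi) (h2lo : u2lo < 0)
    (tbar z2 z4 : ℝ) (hz4 : 0 < z4)
    (that : ℝ) (hthat : that = tbar - Real.pi / (u1hi - u1lo))
    (x : ℝ → ℝ × ℝ × ℝ × ℝ)
    (hx : ∀ t ∈ Icc that tbar, HasDerivAt x (robotF (x t) (u1hi, u2lo)) t)
    (hxT : x tbar = (1, z2, Real.pi / 2, z4)) :
    (∀ t ∈ Ioo that tbar,
      (x t).2.2.1 ∈ Ioo (-(Real.pi / 2)) (Real.pi / 2) ∧
      0 < (x t).2.2.2 ∧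
      (x t).1 < 1) ∧
    (∀ t ∈ Ico that tbar, (x t).1 < 1) := by
  have d1 : ∀ t ∈ Icc that tbar,
      HasDerivAt (fun s => (x s).1) ((x t).2.2.2 * Real.cos (x t).2.2.1) t :=
    fun t ht => (hx t ht).fst
  have d3 : ∀ t ∈ Icc that tbar, HasDerivAt (fun s => (x s).2.2.1) u1hi t :=
    fun t ht => (hx t ht).snd.snd.fst
  have d4 : ∀ t ∈ Icc that tbar, HasDerivAt (fun s => (x s).2.2.2) u2lo t :=
    fun t ht => (hx t ht).snd.snd.snd
  have hD : 0 < u1hi - u1lo := by linarith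
  have hlen : (tbar - that) * (u1hi - u1lo) = Real.pi := by
    rw [hthat]
    field_simp
    ring
  have hpos : ∀ t ∈ Ioo that tbar,
      (x t).2.2.1 ∈ Ioo (-(Real.pi / 2)) (Real.pi / 2) ∧ 0 < (x t).2.2.2 := by
    intro t ht
    have h3 := eq_add_mul_sub_of_hasDerivAt_const d3 (Ioo_subset_Icc_self ht)
    have h4 := eq_add_mul_sub_of_hasDerivAt_const d4 (Ioo_subset_Icc_self ht)
    simp only [hxT] at h3 h4
    obtain ⟨hl, hr⟩ := ht
    refine ⟨⟨?_, ?_⟩, ?_⟩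
    · nlinarith
    · nlinarith
    · nlinarith
  have hmono : StrictMonoOn (fun s => (x s).1) (Icc that tbar) := by
    refine strictMonoOn_of_deriv_pos (convex_Icc _ _)
      (fun t ht => (d1 t ht).continuousAt.continuousWithinAt) fun t ht => ?_
    rw [interior_Icc] at ht
    rw [(d1 t (Ioo_subset_Icc_self ht)).deriv]
    exact mul_pos (hpos t ht).2 (Real.cos_pos_of_mem_Ioo (hpos t ht).1)
  have hlt : ∀ t ∈ Ico that tbar, (x t).1 < 1 := by
    intro t ht
    have h := hmono (Ico_subset_Icc_self ht) (right_mem_Icc.2 (ht.1.trans ht.2.le)) ht.2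
    simpa only [hxT] using h
  exact ⟨fun t ht => ⟨(hpos t ht).1, (hpos t ht).2, hlt t (Ioo_subset_Ico_self ht)⟩, hlt⟩
end

section
/- Let ŭ1 < 0 < ū1, ŭ2 < 0, t̄ ∈ ℝ, t̂ = t̄ − π/(ū1 − ŭ1), z2 ∈ ℝ, z4 > 0. Let x: [t̂, t̄] → ℝ⁴ be the solution of the robot dynamics with constant input ū = (ū1, ŭ2) and terminal condition x(t̄) = (1, z2, π/2, z4), and let λ: [t̂, t̄] → ℝ⁴ be the solution of the adjoint equation along x with λ(t̄) = (1, 0, 0, 0). Then the Hamiltonian t ↦ λ(t)ᵀ f(x(t), ū) is constant on [t̂, t̄] and equal to 0; i.e., λ1(t)·x4(t)·cos(x3(t)) + λ3(t)·ū1 + λ4(t)·ŭ2 = 0 for all t ∈ [t̂, t̄]. -/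
open Set

/-- A function with vanishing derivative on `[a, b]` equals its value at `b` there. -/
theorem eq_right_of_hasDerivAt_zero {f : ℝ → ℝ} {a b : ℝ}
    (hf : ∀ t ∈ Icc a b, HasDerivAt f 0 t) : ∀ t ∈ Icc a b, f t = f b := by
  have h := constant_of_has_deriv_right_zero
    (fun t ht => (hf t ht).continuousAt.continuousWithinAt)
    (fun t ht => (hf t (Ico_subset_Icc_self ht)).hasDerivWithinAt)
  intro t ht
  rw [h t ht, h b (right_mem_Icc.2 (ht.1.trans ht.2))]

/-- Along the barrier curve with constant input ū = (ū₁, ŭ₂) ending at (1, z₂, π/2, z₄)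
and the corresponding adjoint solution with λ(t̄) = (1,0,0,0), the Hamiltonian
t ↦ λ(t)ᵀ f(x(t), ū) is identically zero on [t̂, t̄]; in particular
λ₁(t)·x₄(t)·cos(x₃(t)) + λ₃(t)·ū₁ + λ₄(t)·ŭ₂ = 0 for all t ∈ [t̂, t̄]. -/
theorem barrier_hamiltonian_is_zero (u1lo u1hi u2lo : ℝ)
    (h1lo : u1lo < 0) (h1hi : 0 < u1hi) (h2lo : u2lo < 0)
    (tbar z2 z4 : ℝ) (hz4 : 0 < z4)
    (that : ℝ) (hthat : that = tbar - Real.pi / (u1hi - u1lo))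
    (x : ℝ → ℝ × ℝ × ℝ × ℝ)
    (hx : ∀ t ∈ Icc that tbar, HasDerivAt x (robotF (x t) (u1hi, u2lo)) t)
    (hxT : x tbar = (1, z2, Real.pi / 2, z4))
    (lam1 lam2 lam3 lam4 : ℝ → ℝ)
    (hlam1 : ∀ t ∈ Icc that tbar, HasDerivAt lam1 0 t)
    (hlam2 : ∀ t ∈ Icc that tbar, HasDerivAt lam2 0 t)
    (hlam3 : ∀ t ∈ Icc that tbar,
      HasDerivAt lam3 ((x t).2.2.2 * Real.sin ((x t).2.2.1) * lam1 t
        - (x t).2.2.2 * Real.cos ((x t).2.2.1) * lam2 t) t)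
    (hlam4 : ∀ t ∈ Icc that tbar,
      HasDerivAt lam4 (-Real.cos ((x t).2.2.1) * lam1 t
        - Real.sin ((x t).2.2.1) * lam2 t) t)
    (hterm : lam1 tbar = 1 ∧ lam2 tbar = 0 ∧ lam3 tbar = 0 ∧ lam4 tbar = 0) :
    ∀ t ∈ Icc that tbar,
      lam1 t * ((x t).2.2.2 * Real.cos ((x t).2.2.1))
        + lam2 t * ((x t).2.2.2 * Real.sin ((x t).2.2.1))
        + lam3 t * u1hi + lam4 t * u2lo = 0 ∧
      lam1 t * ((x t).2.2.2 * Real.cos ((x t).2.2.1))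
        + lam3 t * u1hi + lam4 t * u2lo = 0 := by
  obtain ⟨-, hT2, hT3, hT4⟩ := hterm
  have hH := eq_right_of_hasDerivAt_zero (a := that) (b := tbar)
    (f := fun t => lam1 t * ((x t).2.2.2 * Real.cos ((x t).2.2.1))
        + lam2 t * ((x t).2.2.2 * Real.sin ((x t).2.2.1))
        + lam3 t * u1hi + lam4 t * u2lo) (by
      intro t ht
      have hx34 := (hx t ht).hasFDerivAt.snd.snd
      have hx3 : HasDerivAt (fun s => (x s).2.2.1) u1hi t := by
        simpa [robotF] using hx34.fst.hasDerivAt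
      have hx4 : HasDerivAt (fun s => (x s).2.2.2) u2lo t := by
        simpa [robotF] using hx34.snd.hasDerivAt
      refine HasDerivAt.congr_deriv (((((hlam1 t ht).mul (hx4.mul hx3.cos)).add
        ((hlam2 t ht).mul (hx4.mul hx3.sin))).add
        ((hlam3 t ht).mul_const u1hi)).add ((hlam4 t ht).mul_const u2lo)) ?_
      simp only [Pi.mul_apply]
      ring)
  intro t ht
  have h2 : lam2 t = 0 := (eq_right_of_hasDerivAt_zero hlam2 t ht).trans hT2
  have h := hH t ht
  simp only [hxT, hT2, hT3, hT4, Real.cos_pi_div_two, mul_zero, zero_mul, add_zero] at h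
  exact ⟨h, by simpa [h2] using h⟩
end

section
/- The homogeneous approximation of the robot dynamics, ẋ = h(x,u) with h(x,u) = (x4, x3·x4, u1, u2), is globally null controllable without state or input constraints: for every x⁰ ∈ ℝ⁴ there exist a time T ∈ [0, ∞), a measurable, essentially bounded control u: [0, T] → ℝ², and an absolutely continuous function x: [0, T] → ℝ⁴ such that x(0) = x⁰, ẋ(t) = h(x(t), u(t)) for almost every t ∈ [0, T], and x(T) = 0. -/
open Set

/-- The homogeneous approximation h(x,u) = (x₄, x₃·x₄, u₁, u₂) of the robot dynamics,
on ℝ⁴ = ℝ×ℝ×ℝ×ℝ. -/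
def homApprox (x : ℝ × ℝ × ℝ × ℝ) (u : ℝ × ℝ) : ℝ × ℝ × ℝ × ℝ :=
  (x.2.2.2, x.2.2.1 * x.2.2.2, u.1, u.2)

/-- A continuously differentiable trajectory of the homogeneous approximation driven by a
continuous control satisfies the integral form of the dynamics. -/
theorem homApprox_integral_eq {x : ℝ → ℝ × ℝ × ℝ × ℝ} {u : ℝ → ℝ × ℝ} (hu : Continuous u)
    (hx : ∀ t, HasDerivAt x (homApprox (x t) (u t)) t) (t : ℝ) :
    x t = x 0 + ∫ s in (0 : ℝ)..t, homApprox (x s) (u s) := by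
  have hxc : Continuous x := continuous_iff_continuousAt.2 fun t => (hx t).continuousAt
  have hc : Continuous fun s => homApprox (x s) (u s) := by
    unfold homApprox
    fun_prop
  rw [intervalIntegral.integral_eq_sub_of_hasDerivAt (fun s _ => hx s)
    (hc.intervalIntegrable 0 t)]
  abel

/-- The integral of `t * p(t) ^ 2` over `[0, 1]`, where `p(t) = (1 - t) * (d + g * t - 2 * t ^ 2)`,
is positive. -/
theorem weighted_sq_integral_pos (d g : ℝ) :
    0 < d ^ 2 / 12 + d * g / 15 + g ^ 2 / 60 - d / 15 - 4 * g / 105 + 1 / 42 := by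
  nlinarith [sq_nonneg (d + 2 / 5 * g - 2 / 5), sq_nonneg (g - 10 / 7)]

/-- Global null controllability of the homogeneous approximation ẋ = h(x,u) without
state or input constraints: from every initial state there is a finite time T, a
measurable essentially bounded control, and an absolutely continuous trajectory
(a Carathéodory solution, expressed in integral form) steering the state to the origin. -/
theorem homogeneous_approximation_null_controllable :
    ∀ x0 : ℝ × ℝ × ℝ × ℝ, ∃ T : ℝ, 0 ≤ T ∧
      ∃ u : ℝ → ℝ × ℝ, Measurable u ∧ (∃ M : ℝ, ∀ t ∈ Icc (0 : ℝ) T, ‖u t‖ ≤ M) ∧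
      ∃ x : ℝ → ℝ × ℝ × ℝ × ℝ,
        x 0 = x0 ∧
        (∀ t ∈ Icc (0 : ℝ) T, x t = x0 + ∫ s in (0 : ℝ)..t, homApprox (x s) (u s)) ∧
        x T = 0 := by
  rintro ⟨a, b, c, d⟩
  obtain ⟨g, hg⟩ : ∃ g : ℝ, g = 1 - 6 * a - 3 * d := ⟨_, rfl⟩
  obtain ⟨k, hk⟩ : ∃ k : ℝ, b + c * (d / 3 + g / 12 - 1 / 15) +
      k * (d ^ 2 / 12 + d * g / 15 + g ^ 2 / 60 - d / 15 - 4 * g / 105 + 1 / 42) = 0 := by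
    refine ⟨-(b + c * (d / 3 + g / 12 - 1 / 15)) /
      (d ^ 2 / 12 + d * g / 15 + g ^ 2 / 60 - d / 15 - 4 * g / 105 + 1 / 42), ?_⟩
    rw [div_mul_cancel₀ _ (weighted_sq_integral_pos d g).ne']
    ring
  let p : ℝ → ℝ := fun t => (1 - t) * (d + g * t - 2 * t ^ 2)
  let p' : ℝ → ℝ := fun t => (g - d) - 2 * (2 + g) * t + 6 * t ^ 2
  let u : ℝ → ℝ × ℝ := fun t => (-c + k * (p t + t * p' t), p' t)
  let x₁ : ℝ → ℝ := fun t =>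
    a + d * t + (g - d) / 2 * t ^ 2 - (2 + g) / 3 * t ^ 3 + 1 / 2 * t ^ 4
  let x₂ : ℝ → ℝ := fun t =>
    b + c * (d * t + (g - 2 * d) / 2 * t ^ 2 + (d - 2 * g - 2) / 3 * t ^ 3
        + (4 + g) / 4 * t ^ 4 - 2 / 5 * t ^ 5)
      + k * (d ^ 2 / 2 * t ^ 2 + 2 * d * (g - d) / 3 * t ^ 3
        + ((g - d) ^ 2 - 2 * d * (2 + g)) / 4 * t ^ 4
        + (4 * d - 2 * (g - d) * (2 + g)) / 5 * t ^ 5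
        + ((2 + g) ^ 2 + 4 * (g - d)) / 6 * t ^ 6
        - 4 * (2 + g) / 7 * t ^ 7 + 1 / 2 * t ^ 8)
  let x₃ : ℝ → ℝ := fun t => c * (1 - t) + k * (t * p t)
  let x : ℝ → ℝ × ℝ × ℝ × ℝ := fun t => (x₁ t, x₂ t, x₃ t, p t)
  have hmono : ∀ (n : ℕ) (r t : ℝ), HasDerivAt (fun s : ℝ => r * s ^ n) (r * (n * t ^ (n - 1))) t :=
    fun n r t => (hasDerivAt_pow n t).const_mul r
  have hlin : ∀ r t : ℝ, HasDerivAt (fun s : ℝ => r * s) r t := fun r t => by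
    simpa using (hasDerivAt_id t).const_mul r
  have hp : ∀ t, HasDerivAt p (p' t) t := fun t => by
    refine (((hasDerivAt_id t).const_sub 1).mul
      (((hlin g t).const_add d).sub (hmono 2 2 t))).congr_deriv ?_
    simp [p']
    ring
  have h₁ : ∀ t, HasDerivAt x₁ (p t) t := fun t => by
    refine (((((hlin d t).const_add a).add (hmono 2 _ t)).sub (hmono 3 _ t)).add
      (hmono 4 _ t)).congr_deriv ?_
    simp [p]
    ring
  have h₂ : ∀ t, HasDerivAt x₂ (x₃ t * p t) t := fun t => by
    refine ((((((((hlin d t).add (hmono 2 _ t)).add (hmono 3 _ t)).add (hmono 4 _ t)).sub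
      (hmono 5 _ t)).const_mul c).const_add b).add
      ((((((((hmono 2 _ t).add (hmono 3 _ t)).add (hmono 4 _ t)).add (hmono 5 _ t)).add
      (hmono 6 _ t)).sub (hmono 7 _ t)).add (hmono 8 _ t)).const_mul k)).congr_deriv ?_
    simp [x₃, p]
    ring
  have h₃ : ∀ t, HasDerivAt x₃ (u t).1 t := fun t => by
    refine ((((hasDerivAt_id t).const_sub 1).const_mul c).add
      (((hasDerivAt_id t).mul (hp t)).const_mul k)).congr_deriv ?_
    simp [u]
  have hu : Continuous u := by fun_prop
  have hx : ∀ t, HasDerivAt x (homApprox (x t) (u t)) t := fun t =>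
    (h₁ t).prodMk ((h₂ t).prodMk ((h₃ t).prodMk (hp t)))
  have hx0 : x 0 = (a, b, c, d) := by simp [x, x₁, x₂, x₃, p]
  refine ⟨1, zero_le_one, u, hu.measurable,
    isCompact_Icc.exists_bound_of_continuousOn hu.continuousOn, x, hx0,
    fun t _ => hx0 ▸ homApprox_integral_eq hu hx t, ?_⟩
  refine Prod.ext ?_ (Prod.ext ?_ (Prod.ext ?_ ?_))
  · simp only [x, x₁, Prod.fst_zero]
    linear_combination hg / 6
  · simp only [x, x₂, Prod.fst_zero, Prod.snd_zero]
    linear_combination hk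
  · simp [x, x₃, p]
  · simp [x, p]
end
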